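/- arXiv:math/0610357 — 4 statements merged into one kernel-verified Lean document; each statement's English description precedes it below -/
import Mathlib

section
/- Neither the class of connected (nonempty) topological spaces nor the class of compact (nonempty) topological spaces is modally definable: there is no set Γ of modal formulas such that for every nonempty topological space X, X validates all formulas of Γ iff X is connected, and likewise there is no such Γ for compactness. -/
/-- Formulas of the basic modal language. -/
inductive ModalFormula : Type
  | top : ModalFormula
  | prop : ℕ → ModalFormula
  | and : ModalFormula → ModalFormula → ModalFormula
  | neg : ModalFormula → ModalFormula
  | box : ModalFormula → ModalFormula

namespace ModalFormula

/-- Truth of a modal formula at a point of a topological model. -/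
def Holds {X : Type*} [TopologicalSpace X] (ν : ℕ → Set X) : ModalFormula → X → Prop
  | .top, _ => True
  | .prop n, w => w ∈ ν n
  | .and φ ψ, w => Holds ν φ w ∧ Holds ν ψ w
  | .neg φ, w => ¬ Holds ν φ w
  | .box φ, w => ∃ O : Set X, IsOpen O ∧ w ∈ O ∧ ∀ v ∈ O, Holds ν φ v

/-- Validity of a modal formula in a topological space. -/
def Valid (X : Type*) [TopologicalSpace X] (φ : ModalFormula) : Prop :=
  ∀ (ν : ℕ → Set X) (w : X), Holds ν φ w

end ModalFormula

/-- A class of (nonempty) topological spaces is modally definable if there is a set of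
modal formulas whose validity characterizes membership in the class, among all nonempty
topological spaces. -/
def ModallyDefinable (K : (X : Type) → TopologicalSpace X → Prop) : Prop :=
  ∃ Γ : Set ModalFormula, ∀ (X : Type) (t : TopologicalSpace X), Nonempty X →
    (K X t ↔ ∀ φ ∈ Γ, @ModalFormula.Valid X t φ)


/-- Truth of modal formulas is invariant under pulling back along continuous open maps. -/
theorem ModalFormula.holds_preimage_iff {X Y : Type*} [TopologicalSpace X] [TopologicalSpace Y]
    {f : Y → X} (hf : Continuous f) (hf' : IsOpenMap f) (ν : ℕ → Set X) (φ : ModalFormula)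
    (y : Y) : Holds (fun n => f ⁻¹' ν n) φ y ↔ Holds ν φ (f y) := by
  induction φ generalizing y with
  | top => exact Iff.rfl
  | prop n => exact Iff.rfl
  | and φ ψ ihφ ihψ => exact and_congr (ihφ y) (ihψ y)
  | neg φ ih => exact not_congr (ih y)
  | box φ ih =>
    constructor
    · rintro ⟨O, hO, hy, h⟩
      refine ⟨f '' O, hf' O hO, ⟨y, hy, rfl⟩, ?_⟩
      rintro _ ⟨v, hv, rfl⟩
      exact (ih v).1 (h v hv)
    · rintro ⟨O, hO, hy, h⟩
      exact ⟨f ⁻¹' O, hO.preimage hf, hy, fun v hv => (ih v).2 (h _ hv)⟩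

/-- Every formula valid in the one-point space is valid in all discrete spaces. -/
theorem ModalFormula.Valid.of_unit {X : Type*} [TopologicalSpace X] [DiscreteTopology X]
    {φ : ModalFormula} (h : Valid Unit φ) : Valid X φ := fun ν w =>
  (holds_preimage_iff (f := fun _ : Unit => w) continuous_const
    (fun _ _ => isOpen_discrete _) ν φ ()).1 (h _ ())

/-- A modally definable class containing the one-point space contains all nonempty discrete
spaces. -/
theorem ModallyDefinable.of_unit {K : (X : Type) → TopologicalSpace X → Prop}
    (hK : ModallyDefinable K) (h : K Unit inferInstance) (X : Type) [t : TopologicalSpace X]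
    [DiscreteTopology X] [hX : Nonempty X] : K X t := by
  obtain ⟨Γ, hΓ⟩ := hK
  exact (hΓ X t hX).2 fun φ hφ => ((hΓ Unit _ ⟨()⟩).1 h φ hφ).of_unit

theorem statement9 :
    ¬ ModallyDefinable (fun X t => @ConnectedSpace X t) ∧
    ¬ ModallyDefinable (fun X t => @CompactSpace X t) := by
  constructor
  · intro h
    have hBool : ConnectedSpace Bool := h.of_unit inferInstance Bool
    have := PreconnectedSpace.trivial_of_discrete (X := Bool)
    exact Bool.false_ne_true (Subsingleton.elim _ _)
  · intro h
    have hNat : CompactSpace ℕ := h.of_unit inferInstance ℕ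
    exact not_finite_iff_infinite.2 inferInstance (finite_of_compact_of_discrete (X := ℕ))
end

section
/- None of the separation classes T₀, T₁, T₂ is modally definable: for each i ∈ {0,1,2}, there is no set Γ of modal formulas such that for every nonempty topological space X, X validates all formulas of Γ iff X is a T_i space. -/
namespace ModalFormula

/-- Truth is invariant under continuous open maps, pulling the valuation back. -/
theorem holds_preimage_iff_s11 {X Y : Type*} [TopologicalSpace X] [TopologicalSpace Y] {f : X → Y}
    (hc : Continuous f) (ho : IsOpenMap f) (ν : ℕ → Set Y) (φ : ModalFormula) (x : X) :
    Holds (fun n => f ⁻¹' ν n) φ x ↔ Holds ν φ (f x) := by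
  induction φ generalizing x with
  | top => exact Iff.rfl
  | prop n => exact Iff.rfl
  | and φ ψ ihφ ihψ => exact and_congr (ihφ x) (ihψ x)
  | neg φ ih => exact not_congr (ih x)
  | box φ ih =>
    constructor
    · rintro ⟨O, hO, hx, h⟩
      refine ⟨f '' O, ho O hO, Set.mem_image_of_mem f hx, ?_⟩
      rintro _ ⟨v, hv, rfl⟩
      exact (ih v).1 (h v hv)
    · rintro ⟨O, hO, hx, h⟩
      exact ⟨f ⁻¹' O, hO.preimage hc, hx, fun v hv => (ih v).2 (h (f v) hv)⟩

/-- Validity is preserved by continuous open surjections. -/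
theorem Valid.of_isOpenMap {X Y : Type*} [TopologicalSpace X] [TopologicalSpace Y] {f : X → Y}
    (hc : Continuous f) (ho : IsOpenMap f) (hs : Function.Surjective f) {φ : ModalFormula}
    (h : Valid X φ) : Valid Y φ := by
  intro ν y
  obtain ⟨x, rfl⟩ := hs y
  exact (holds_preimage_iff_s11 hc ho ν φ x).1 (h _ x)

end ModalFormula

/-- A map to an indiscrete space all of whose fibres are dense is open. -/
theorem isOpenMap_top_of_dense_fibers {X Y : Type*} [TopologicalSpace X] {f : X → Y}
    (hf : ∀ y, Dense (f ⁻¹' {y})) : @IsOpenMap X Y _ ⊤ f := by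
  intro O hO
  rcases O.eq_empty_or_nonempty with rfl | hne
  · rw [Set.image_empty]
    exact @isOpen_empty Y ⊤
  · have himage : f '' O = Set.univ := Set.eq_univ_of_forall fun y => by
      obtain ⟨x, hxO, hx⟩ := (hf y).inter_open_nonempty O hO hne
      exact ⟨x, hxO, hx⟩
    rw [himage]
    exact @isOpen_univ Y ⊤

/-- The two-point indiscrete space validates every formula valid in the real line. -/
theorem ModalFormula.Valid.indiscrete_of_real {φ : ModalFormula} (h : ModalFormula.Valid ℝ φ) :
    @ModalFormula.Valid Prop ⊤ φ := by
  have hdense : ∀ p : Prop, Dense (Irrational ⁻¹' {p}) := by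
    intro p
    by_cases hp : p
    · convert dense_irrational using 1
      ext x
      simp [hp]
    · have hrat : Dense (Set.range ((↑) : ℚ → ℝ)) := Rat.denseRange_cast
      convert hrat using 1
      ext x
      simp [hp, Irrational]
  refine @ModalFormula.Valid.of_isOpenMap ℝ Prop _ ⊤ Irrational continuous_top
    (isOpenMap_top_of_dense_fibers hdense) (fun p => ?_) φ h
  obtain ⟨x, hx⟩ := (hdense p).nonempty
  exact ⟨x, hx⟩

/-- A class containing the real line and contained in the T₀ spaces is not modally definable. -/
theorem not_modallyDefinable_of_real {K : (X : Type) → TopologicalSpace X → Prop}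
    (hreal : K ℝ inferInstance) (hK : ∀ X t, K X t → @T0Space X t) : ¬ ModallyDefinable K := by
  rintro ⟨Γ, hΓ⟩
  have hvalid := (hΓ ℝ inferInstance inferInstance).1 hreal
  have hT0 : @T0Space Prop ⊤ := hK _ _ <|
    (hΓ Prop ⊤ inferInstance).2 fun φ hφ => (hvalid φ hφ).indiscrete_of_real
  refine true_ne_false ((@t0Space_iff_inseparable Prop ⊤).1 hT0 True False ?_)
  simp [Inseparable, nhds_top]

theorem statement11 :
    ¬ ModallyDefinable (fun X t => @T0Space X t) ∧
    ¬ ModallyDefinable (fun X t => @T1Space X t) ∧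
    ¬ ModallyDefinable (fun X t => @T2Space X t) := by
  exact ⟨not_modallyDefinable_of_real (inferInstanceAs (T0Space ℝ)) fun _ _ h => h,
    not_modallyDefinable_of_real (inferInstanceAs (T1Space ℝ)) fun _ _ _ => inferInstance,
    not_modallyDefinable_of_real (inferInstanceAs (T2Space ℝ)) fun _ _ _ => inferInstance⟩
end

section
/- Let (X_i)_{i∈I} be a family of topological spaces and D an ultrafilter on I. Then the topological ultraproduct ∏_D X_i is homeomorphic to an open subspace of the topological ultrapower over D of the topological sum Σ_{i∈I} X_i; concretely, the natural map from ∏_D X_i into ∏_D (Σ_{i∈I} X_i) induced by the inclusions X_i ↪ Σ X_i is injective, continuous, and open (an open embedding). -/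
/-- The equivalence relation of agreement on a D-large set of indices. -/
def ultraSetoid {I : Type*} (D : Ultrafilter I) (X : I → Type*) : Setoid (∀ i, X i) where
  r a b := {i | a i = b i} ∈ D
  iseqv := by
    refine ⟨fun a => ?_, fun {a b} h => ?_, fun {a b c} h₁ h₂ => ?_⟩
    · have : {i | a i = a i} = Set.univ := by simp
      rw [this]; exact Filter.univ_mem
    · exact Filter.mem_of_superset h fun i hi => (hi : a i = b i).symm
    · exact Filter.mem_of_superset (Filter.inter_mem h₁ h₂)
        fun i hi => (hi.1 : a i = b i).trans hi.2

/-- The topological ultraproduct of a family of topological spaces over an ultrafilter: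
the quotient of the product by D-a.e. agreement, with the topology generated by the
ultraboxes determined by families of open sets. -/
def ultraTopology {I : Type*} (D : Ultrafilter I) (X : I → Type*)
    [∀ i, TopologicalSpace (X i)] : TopologicalSpace (Quotient (ultraSetoid D X)) :=
  TopologicalSpace.generateFrom
    {U : Set (Quotient (ultraSetoid D X)) | ∃ O : ∀ i, Set (X i), (∀ i, IsOpen (O i)) ∧
      U = Quotient.mk (ultraSetoid D X) '' {a | {i | a i ∈ O i} ∈ D}}

open scoped Topology

/-- Membership in an ultrabox can be tested on any representative. -/
theorem mk_mem_ultrabox {I : Type*} {D : Ultrafilter I} {X : I → Type*} {O : ∀ i, Set (X i)}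
    {a : ∀ i, X i} :
    Quotient.mk (ultraSetoid D X) a ∈
      Quotient.mk (ultraSetoid D X) '' {a | {i | a i ∈ O i} ∈ D} ↔ {i | a i ∈ O i} ∈ D := by
  refine ⟨?_, fun h => ⟨a, h, rfl⟩⟩
  rintro ⟨b, hb, hba⟩
  have hba : {i | b i = a i} ∈ D := Quotient.exact hba
  exact Filter.mem_of_superset (Filter.inter_mem hb hba)
    fun i ⟨(hi : b i ∈ O i), (hab : b i = a i)⟩ => show a i ∈ O i from hab ▸ hi

theorem isOpen_ultrabox {I : Type*} (D : Ultrafilter I) {X : I → Type*}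
    [∀ i, TopologicalSpace (X i)] {O : ∀ i, Set (X i)} (hO : ∀ i, IsOpen (O i)) :
    IsOpen[ultraTopology D X] (Quotient.mk (ultraSetoid D X) '' {a | {i | a i ∈ O i} ∈ D}) :=
  TopologicalSpace.isOpen_generateFrom_of_mem ⟨O, hO, rfl⟩

/-- The map of ultraproducts induced by the inclusions of the summands into the sum. -/
def ultraSigmaMk {I : Type*} (D : Ultrafilter I) (X : I → Type*) :
    Quotient (ultraSetoid D X) → Quotient (ultraSetoid D (fun _ : I => Σ i, X i)) :=
  Quotient.map (fun a i => ⟨i, a i⟩) fun _ _ h =>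
    Filter.mem_of_superset h fun i hi => congrArg (Sigma.mk i) hi

theorem ultraSigmaMk_injective {I : Type*} (D : Ultrafilter I) (X : I → Type*) :
    Function.Injective (ultraSigmaMk D X) := by
  rintro ⟨a⟩ ⟨b⟩ h
  have h : {i | (⟨i, a i⟩ : Σ i, X i) = ⟨i, b i⟩} ∈ D := Quotient.exact h
  exact Quotient.sound (Filter.mem_of_superset h fun i hi => sigma_mk_injective hi)

theorem preimage_ultraSigmaMk_ultrabox {I : Type*} (D : Ultrafilter I) (X : I → Type*)
    (O : I → Set (Σ i, X i)) :
    ultraSigmaMk D X ⁻¹' (Quotient.mk (ultraSetoid D (fun _ : I => Σ i, X i)) ''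
        {a | {i | a i ∈ O i} ∈ D}) =
      Quotient.mk (ultraSetoid D X) '' {a | {i | a i ∈ Sigma.mk i ⁻¹' O i} ∈ D} := by
  ext q
  induction q using Quotient.inductionOn
  exact mk_mem_ultrabox.trans (mk_mem_ultrabox (O := fun i => Sigma.mk i ⁻¹' O i)).symm

theorem ultraSigmaMk_isInducing {I : Type*} (D : Ultrafilter I) (X : I → Type*)
    [∀ i, TopologicalSpace (X i)] :
    @Topology.IsInducing _ _ (ultraTopology D X) (ultraTopology D (fun _ : I => Σ i, X i))
      (ultraSigmaMk D X) := by
  let _ := ultraTopology D X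
  let _ := ultraTopology D (fun _ : I => Σ i, X i)
  refine ⟨le_antisymm (continuous_iff_le_induced.1 (continuous_generateFrom_iff.2 ?_))
    (le_generateFrom ?_)⟩
  · rintro _ ⟨O, hO, rfl⟩
    rw [preimage_ultraSigmaMk_ultrabox]
    exact isOpen_ultrabox D fun i => (hO i).preimage continuous_sigmaMk
  · rintro _ ⟨O, hO, rfl⟩
    refine ⟨_, isOpen_ultrabox D fun i => isOpenMap_sigmaMk _ (hO i), ?_⟩
    simp only [preimage_ultraSigmaMk_ultrabox, Set.preimage_image_eq _ sigma_mk_injective]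

theorem isOpen_range_ultraSigmaMk {I : Type*} (D : Ultrafilter I) (X : I → Type*)
    [∀ i, TopologicalSpace (X i)] :
    IsOpen[ultraTopology D (fun _ : I => Σ i, X i)] (Set.range (ultraSigmaMk D X)) := by
  let _ := ultraTopology D (fun _ : I => Σ i, X i)
  rcases isEmpty_or_nonempty (∀ i, X i) with h | ⟨⟨c⟩⟩
  · have : IsEmpty (Quotient (ultraSetoid D X)) := ⟨fun q => h.elim q.out⟩
    rw [Set.range_eq_empty]
    exact isOpen_empty
  · convert isOpen_ultrabox D (X := fun _ : I => Σ i, X i)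
      (O := fun i => Set.range (Sigma.mk i)) fun i => isOpen_range_sigmaMk
    ext q
    constructor
    · rintro ⟨⟨a⟩, rfl⟩
      exact mk_mem_ultrabox.2 (Filter.univ_mem' fun i => ⟨a i, rfl⟩)
    · rintro ⟨b, hb, rfl⟩
      have hex : ∀ i, ∃ x : X i, b i ∈ Set.range (Sigma.mk i) → ⟨i, x⟩ = b i := fun i => by
        by_cases hi : b i ∈ Set.range (Sigma.mk i)
        · exact hi.imp fun x hx _ => hx
        · exact ⟨c i, fun h => absurd h hi⟩
      choose a ha using hex
      exact ⟨Quotient.mk _ a, Quotient.sound (Filter.mem_of_superset hb ha)⟩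

theorem statement14 {I : Type*} (X : I → Type*) [∀ i, TopologicalSpace (X i)]
    (D : Ultrafilter I) :
    ∃ f : Quotient (ultraSetoid D X) → Quotient (ultraSetoid D (fun _ : I => Σ i, X i)),
      (∀ a : ∀ i, X i,
        f (Quotient.mk (ultraSetoid D X) a) =
          Quotient.mk (ultraSetoid D (fun _ : I => Σ i, X i)) (fun i => ⟨i, a i⟩)) ∧
      Function.Injective f ∧
      @Continuous _ _ (ultraTopology D X) (ultraTopology D (fun _ : I => Σ i, X i)) f ∧
      @IsOpenMap _ _ (ultraTopology D X) (ultraTopology D (fun _ : I => Σ i, X i)) f := by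
  let _ := ultraTopology D X
  let _ := ultraTopology D (fun _ : I => Σ i, X i)
  have hind := ultraSigmaMk_isInducing D X
  exact ⟨ultraSigmaMk D X, fun _ => rfl, ultraSigmaMk_injective D X, hind.continuous,
    hind.isOpenMap (isOpen_range_ultraSigmaMk D X)⟩
end

section
/- Validity of H(E)-formulas is preserved under u-morphic images: if X and Y are topological spaces, f : X → Y* is a surjective interior map into the Alexandroff extension of Y such that for every y ∈ Y the principal ultrafilter at y has exactly one f-preimage, and φ is an H(E)-formula valid in X, then φ is valid in Y. -/
/-- A filter is open if it is closed under taking interiors. -/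
def IsOpenFilter {X : Type*} [TopologicalSpace X] (F : Filter X) : Prop :=
  ∀ A ∈ F, interior A ∈ F

/-- The Alexandroff extension of a topological space: the set of ultrafilters on X with the
topology generated by the sets of ultrafilters extending a fixed open filter. -/
def alexandroffTopology (X : Type*) [TopologicalSpace X] : TopologicalSpace (Ultrafilter X) :=
  TopologicalSpace.generateFrom
    {O : Set (Ultrafilter X) |
      ∃ F : Filter X, IsOpenFilter F ∧ O = {u : Ultrafilter X | (u : Filter X) ≤ F}}

/-- Formulas of the hybrid language H(E): propositional letters, nominals, Booleans,
box, satisfaction operators and the global modality. -/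
inductive HEFormula : Type
  | top : HEFormula
  | prop : ℕ → HEFormula
  | nom : ℕ → HEFormula
  | and : HEFormula → HEFormula → HEFormula
  | neg : HEFormula → HEFormula
  | box : HEFormula → HEFormula
  | satOp : ℕ → HEFormula → HEFormula
  | ex : HEFormula → HEFormula

namespace HEFormula

/-- Truth of an H(E)-formula at a point of a hybrid topological model, where
ν interprets propositional letters and g gives the denotations of the nominals. -/
def Holds {X : Type*} [TopologicalSpace X] (ν : ℕ → Set X) (g : ℕ → X) :
    HEFormula → X → Prop
  | .top, _ => True
  | .prop n, w => w ∈ ν n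
  | .nom n, w => w = g n
  | .and φ ψ, w => Holds ν g φ w ∧ Holds ν g ψ w
  | .neg φ, w => ¬ Holds ν g φ w
  | .box φ, w => ∃ O : Set X, IsOpen O ∧ w ∈ O ∧ ∀ v ∈ O, Holds ν g φ v
  | .satOp n φ, _ => Holds ν g φ (g n)
  | .ex φ, _ => ∃ v : X, Holds ν g φ v

/-- Validity of an H(E)-formula in a topological space: truth at every point under every
hybrid valuation. -/
def Valid (X : Type*) [TopologicalSpace X] (φ : HEFormula) : Prop :=
  ∀ (ν : ℕ → Set X) (g : ℕ → X) (w : X), Holds ν g φ w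

end HEFormula

open scoped Topology

lemma IsOpenFilter.inf {Y : Type*} [TopologicalSpace Y] {F G : Filter Y}
    (hF : IsOpenFilter F) (hG : IsOpenFilter G) : IsOpenFilter (F ⊓ G) := by
  intro A hA
  obtain ⟨B, hB, C, hC, rfl⟩ := Filter.mem_inf_iff.1 hA
  rw [interior_inter]
  exact Filter.inter_mem_inf (hF B hB) (hG C hC)

lemma IsOpenFilter.principal {Y : Type*} [TopologicalSpace Y] {U : Set Y} (hU : IsOpen U) :
    IsOpenFilter (Filter.principal U) :=
  fun _ hA => Filter.mem_principal.2 (interior_maximal (Filter.mem_principal.1 hA) hU)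

/-- The sets of ultrafilters extending an open filter form a basis of the Alexandroff extension. -/
lemma exists_isOpenFilter_of_isOpen {Y : Type*} [TopologicalSpace Y] {U : Set (Ultrafilter Y)}
    (hU : IsOpen[alexandroffTopology Y] U) {u : Ultrafilter Y} (hu : u ∈ U) :
    ∃ F : Filter Y, IsOpenFilter F ∧ (u : Filter Y) ≤ F ∧
      ∀ v : Ultrafilter Y, (v : Filter Y) ≤ F → v ∈ U := by
  change TopologicalSpace.GenerateOpen _ U at hU
  induction hU with
  | basic s hs =>
    obtain ⟨F, hF, rfl⟩ := hs
    exact ⟨F, hF, hu, fun _ hv => hv⟩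
  | univ => exact ⟨⊤, fun A hA => by simp_all, le_top, fun _ _ => trivial⟩
  | inter s t _ _ hs ht =>
    obtain ⟨F, hF, huF, hFs⟩ := hs hu.1
    obtain ⟨G, hG, huG, hGt⟩ := ht hu.2
    exact ⟨F ⊓ G, hF.inf hG, le_inf huF huG, fun v hv =>
      ⟨hFs v (hv.trans inf_le_left), hGt v (hv.trans inf_le_right)⟩⟩
  | sUnion S _ ih =>
    obtain ⟨s, hs, hus⟩ := hu
    obtain ⟨F, hF, huF, hFs⟩ := ih s hs hus
    exact ⟨F, hF, huF, fun v hv => ⟨s, hs, hFs v hv⟩⟩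

lemma isOpen_setOf_mem_ultrafilter {Y : Type*} [TopologicalSpace Y] {U : Set Y} (hU : IsOpen U) :
    IsOpen[alexandroffTopology Y] {u : Ultrafilter Y | U ∈ u} :=
  TopologicalSpace.GenerateOpen.basic _
    ⟨Filter.principal U, IsOpenFilter.principal hU, by ext u; simp⟩

/-- The interior of `{u | A ∈ u}` in the Alexandroff extension is contained in
`{u | interior A ∈ u}`. -/
lemma interior_mem_of_isOpen {Y : Type*} [TopologicalSpace Y] {U : Set (Ultrafilter Y)}
    (hU : IsOpen[alexandroffTopology Y] U) {A : Set Y} (hA : ∀ v ∈ U, A ∈ v)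
    {u : Ultrafilter Y} (hu : u ∈ U) : interior A ∈ u := by
  obtain ⟨F, hF, huF, hFU⟩ := exists_isOpenFilter_of_isOpen hU hu
  exact huF (hF A (Filter.mem_iff_ultrafilter.2 fun v hv => hA v (hFU v hv)))

namespace HEFormula

lemma setOf_holds_box {Y : Type*} [TopologicalSpace Y] (ν : ℕ → Set Y) (g : ℕ → Y)
    (φ : HEFormula) :
    {y | Holds ν g (.box φ) y} = interior {y | Holds ν g φ y} := by
  ext y
  rw [mem_interior]
  exact ⟨fun ⟨O, hO, hy, h⟩ => ⟨O, h, hO, hy⟩, fun ⟨O, h, hO, hy⟩ => ⟨O, hO, hy, h⟩⟩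

/-- Truth lemma for u-morphisms: a formula holds at `x` under the pulled-back valuation iff its
truth set belongs to the ultrafilter `f x`. -/
lemma holds_iff_setOf_holds_mem {X Y : Type*} [TopologicalSpace X] [TopologicalSpace Y]
    {f : X → Ultrafilter Y}
    (hcont : @Continuous X (Ultrafilter Y) _ (alexandroffTopology Y) f)
    (hopen : @IsOpenMap X (Ultrafilter Y) _ (alexandroffTopology Y) f)
    {s : Y → X} (hs : ∀ x y, f x = pure y ↔ x = s y)
    (ν : ℕ → Set Y) (g : ℕ → Y) (φ : HEFormula) (x : X) :
    Holds (fun n => {x | ν n ∈ f x}) (fun n => s (g n)) φ x ↔ {y | Holds ν g φ y} ∈ f x := by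
  have hfs : ∀ y, f (s y) = pure y := fun y => (hs _ _).2 rfl
  induction φ generalizing x with
  | top => exact ⟨fun _ => Filter.univ_mem' fun _ => trivial, fun _ => trivial⟩
  | prop n => simp [Holds]
  | nom n =>
    simp only [Holds, Set.ofPred_eq_eq_singleton]
    rw [← hs]
    refine ⟨fun h => by simp [h], fun h => ?_⟩
    exact Ultrafilter.coe_le_coe.1 (by simpa using h)
  | and φ ψ ihφ ihψ =>
    simp only [Holds, ihφ, ihψ, Set.ofPred_and]
    exact Filter.inter_mem_iff.symm
  | neg φ ih =>
    simp only [Holds, ih]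
    exact Ultrafilter.compl_mem_iff_notMem.symm
  | box φ ih =>
    rw [setOf_holds_box]
    simp only [Holds, ih]
    constructor
    · rintro ⟨O, hO, hx, h⟩
      exact interior_mem_of_isOpen (hopen O hO) (Set.forall_mem_image.2 h)
        (Set.mem_image_of_mem f hx)
    · intro h
      exact ⟨_, (@continuous_def _ _ _ (alexandroffTopology Y) f).1 hcont _
        (isOpen_setOf_mem_ultrafilter isOpen_interior), h,
        fun v hv => Filter.mem_of_superset hv interior_subset⟩
  | satOp n φ ih =>
    simp only [Holds, ih, hfs]
    rw [Ultrafilter.mem_pure]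
    exact (Filter.eventually_const (f := (f x : Filter Y))).symm
  | ex φ ih =>
    simp only [Holds, ih]
    constructor
    · rintro ⟨v, hv⟩
      obtain ⟨y, hy⟩ := (f v).nonempty_of_mem hv
      exact Filter.mem_of_superset Filter.univ_mem fun _ _ => ⟨y, hy⟩
    · intro h
      obtain ⟨_, y, hy⟩ := (f x).nonempty_of_mem h
      exact ⟨s y, by simpa [hfs] using hy⟩

end HEFormula

theorem statement18 {X Y : Type*} [TopologicalSpace X] [TopologicalSpace Y]
    (f : X → Ultrafilter Y)
    (hsurj : Function.Surjective f)
    (hcont : @Continuous X (Ultrafilter Y) _ (alexandroffTopology Y) f)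
    (hopen : @IsOpenMap X (Ultrafilter Y) _ (alexandroffTopology Y) f)
    (hprin : ∀ y : Y, ∃! x : X, f x = pure y)
    (φ : HEFormula) :
    HEFormula.Valid X φ → HEFormula.Valid Y φ := by
  intro hX ν g w
  choose s hfs huniq using hprin
  have hs : ∀ x y, f x = pure y ↔ x = s y := fun x y =>
    ⟨huniq y x, fun h => h ▸ hfs y⟩
  have h := (HEFormula.holds_iff_setOf_holds_mem hcont hopen hs ν g φ (s w)).1 (hX _ _ _)
  rw [(hs _ _).2 rfl] at h
  exact Ultrafilter.mem_pure.1 h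
end
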